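/- In the two-block stochastic block model SBM(n,a,b) with d := a+b, let Ā₀ = E[A₀] be the expected adjacency matrix, let Ā be obtained from Ā₀ by zeroing out the rows and columns corresponding to the vertices whose degree in the sampled graph exceeds 20d, and set Δ := Ā − Ā₀. Then for d₀ sufficiently large (d ≥ d₀), with probability at least 1 − exp(−Ω(a⁻³·n)) the operator norm satisfies ‖Δ‖ ≤ 1. -/

import Mathlib

open MeasureTheory Filter Finset

/-- The Bernoulli measure on `Bool` with success probability `p` (clamped to `[0,1]`). -/
noncomputable def bern (p : ℝ) : Measure Bool :=
  (PMF.bernoulli (min (Real.toNNReal p) 1) (min_le_right _ _)).toMeasure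

instance (p : ℝ) : IsProbabilityMeasure (bern p) := by
  unfold bern; infer_instance

/-- Index set for the unordered pairs of distinct vertices of `Fin N`. -/
abbrev EdgeIdx (N : ℕ) := {e : Fin N × Fin N // e.1 < e.2}

/-- A configuration of edges: which unordered pairs form an edge. -/
abbrev Config (N : ℕ) := EdgeIdx N → Bool

/-- A colored configuration: for every pair, (edge present, edge Red). For the censor
block model the second component is instead the noise bit of the pair. -/
abbrev CConfig (N : ℕ) := EdgeIdx N → Bool × Bool

/-- Adjacency relation of the graph determined by a configuration. -/
def adjOf {N : ℕ} (ω : Config N) (i j : Fin N) : Bool :=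
  if h : i < j then ω ⟨(i, j), h⟩ else if h : j < i then ω ⟨(j, i), h⟩ else false

/-- Degree of a vertex in the graph determined by a configuration. -/
def degOf {N : ℕ} (ω : Config N) (v : Fin N) : ℕ :=
  (univ.filter fun j => adjOf ω v j).card

/-- The two-block stochastic block model `SBM(n,a,b)` on `2*n` vertices: within-block
pairs are edges with probability `a/n`, cross-block pairs with probability `b/n`,
independently. -/
noncomputable def sbm2 (n : ℕ) (a b : ℝ) : Measure (Config (2 * n)) :=
  Measure.pi fun e =>
    bern (if ((e.1.1 : ℕ) < n ↔ (e.1.2 : ℕ) < n) then a / n else b / n)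

/-- The first block `V₁` (the first `n` vertices). -/
def block1 (n : ℕ) : Finset (Fin (2 * n)) := univ.filter fun i => (i : ℕ) < n

/-- The second block `V₂` (the last `n` vertices). -/
def block2 (n : ℕ) : Finset (Fin (2 * n)) := univ.filter fun i => ¬ (i : ℕ) < n

/-- `(V₁', V₂')` is `γ`-correct: `|Vᵢ ∩ Vᵢ'| ≥ (1-γ)n` for `i = 1,2`. -/
def correct2 (n : ℕ) (γ : ℝ) (P : Finset (Fin (2 * n)) × Finset (Fin (2 * n))) : Prop :=
  (1 - γ) * (n : ℝ) ≤ ((block1 n ∩ P.1).card : ℝ) ∧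
  (1 - γ) * (n : ℝ) ≤ ((block2 n ∩ P.2).card : ℝ)

/-- A pair of disjoint subsets partitioning the vertex set. -/
def isPartition2 {N : ℕ} (P : Finset (Fin N) × Finset (Fin N)) : Prop :=
  Disjoint P.1 P.2 ∧ P.1 ∪ P.2 = univ

/-- Expected adjacency matrix of `SBM(n,a,b)`. -/
noncomputable def expAdj (n : ℕ) (a b : ℝ) : Matrix (Fin (2 * n)) (Fin (2 * n)) ℝ :=
  fun i j => if i = j then 0 else if ((i : ℕ) < n ↔ (j : ℕ) < n) then a / n else b / n

/-- Adjacency matrix (over `ℝ`) of the graph determined by a configuration. -/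
noncomputable def adjMat {N : ℕ} (ω : Config N) : Matrix (Fin N) (Fin N) ℝ :=
  fun i j => if adjOf ω i j then 1 else 0

/-- Zero out all rows and columns corresponding to vertices of degree `> 20 d`. -/
noncomputable def zeroOutHighDeg {N : ℕ} (d : ℝ) (ω : Config N)
    (M : Matrix (Fin N) (Fin N) ℝ) : Matrix (Fin N) (Fin N) ℝ :=
  fun i j => if 20 * d < (degOf ω i : ℝ) ∨ 20 * d < (degOf ω j : ℝ) then 0 else M i j

/-- The spectral (ℓ² operator) norm of a real square matrix. -/
noncomputable def opNorm {N : ℕ} (M : Matrix (Fin N) (Fin N) ℝ) : ℝ :=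
  ‖LinearMap.toContinuousLinearMap (Matrix.toEuclideanLin M)‖

/-- The orthogonal projection onto a subspace, as an endomorphism. -/
noncomputable def projCLM {N : ℕ} (W : Submodule ℝ (EuclideanSpace ℝ (Fin N))) :
    EuclideanSpace ℝ (Fin N) →L[ℝ] EuclideanSpace ℝ (Fin N) :=
  W.subtypeL.comp (Submodule.orthogonalProjectionOnto W)

/-- `sin ∠(W₁, W₂) := ‖P_{W₁} - P_{W₂}‖`. -/
noncomputable def sinAngle {N : ℕ} (W₁ W₂ : Submodule ℝ (EuclideanSpace ℝ (Fin N))) : ℝ :=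
  ‖projCLM W₁ - projCLM W₂‖

/-- Build a vector of `EuclideanSpace ℝ (Fin N)` from its coordinates. -/
noncomputable def mkVec {N : ℕ} (f : Fin N → ℝ) : EuclideanSpace ℝ (Fin N) :=
  (EuclideanSpace.equiv (Fin N) ℝ).symm f

/-- `W` is the eigenspace corresponding to the top two eigenvalues of the symmetric
matrix `M`: it is spanned by two orthonormal eigenvectors whose eigenvalues dominate
every eigenvalue attained on `Wᗮ`. -/
def IsTopTwoSpace {N : ℕ} (M : Matrix (Fin N) (Fin N) ℝ)
    (W : Submodule ℝ (EuclideanSpace ℝ (Fin N))) : Prop :=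
  ∃ (u₁ u₂ : EuclideanSpace ℝ (Fin N)) (μ₁ μ₂ : ℝ),
    (inner ℝ u₁ u₂ : ℝ) = 0 ∧ ‖u₁‖ = 1 ∧ ‖u₂‖ = 1 ∧
    W = Submodule.span ℝ {u₁, u₂} ∧
    Matrix.toEuclideanLin M u₁ = μ₁ • u₁ ∧
    Matrix.toEuclideanLin M u₂ = μ₂ • u₂ ∧
    ∀ (μ : ℝ) (v : EuclideanSpace ℝ (Fin N)), v ≠ 0 → v ∈ Wᗮ →
      Matrix.toEuclideanLin M v = μ • v → μ ≤ min μ₁ μ₂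

/-- `P` is a possible output of the **Spectral Partition** algorithm run on the
configuration `ω` with degree parameter `d`. -/
def IsSpectralOutput (n : ℕ) (ω : Config (2 * n)) (d : ℝ)
    (P : Finset (Fin (2 * n)) × Finset (Fin (2 * n))) : Prop :=
  ∃ (W : Submodule ℝ (EuclideanSpace ℝ (Fin (2 * n))))
    (v : EuclideanSpace ℝ (Fin (2 * n))),
    IsTopTwoSpace (zeroOutHighDeg d ω (adjMat ω)) W ∧
    v ∈ W ∧ ‖v‖ = 1 ∧ (inner ℝ (projCLM W (mkVec fun _ => 1)) v : ℝ) = 0 ∧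
    P.1.card = n ∧ P.2 = P.1ᶜ ∧ ∀ i ∈ P.1, ∀ j ∈ P.2, v j ≤ v i

/-- The two-block SBM together with an independent fair Red/Blue coloring of each edge:
first component = edge present, second component = edge colored Red. -/
noncomputable def sbm2c (n : ℕ) (a b : ℝ) : Measure (CConfig (2 * n)) :=
  Measure.pi fun e =>
    (bern (if ((e.1.1 : ℕ) < n ↔ (e.1.2 : ℕ) < n) then a / n else b / n)).prod
      (bern (1 / 2))

/-- The Red subgraph of a colored configuration. -/
def redConf {N : ℕ} (ω : CConfig N) : Config N := fun e => (ω e).1 && (ω e).2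

/-- The Blue subgraph of a colored configuration. -/
def blueConf {N : ℕ} (ω : CConfig N) : Config N := fun e => (ω e).1 && !(ω e).2

/-- Number of Blue neighbors of `u` inside `S`. -/
noncomputable def blueDegIn {N : ℕ} (ω : CConfig N) (S : Finset (Fin N)) (u : Fin N) : ℕ :=
  (S.filter fun v => adjOf (blueConf ω) u v).card

/-- Number of Red neighbors of `u` inside `S`. -/
noncomputable def redDegIn {N : ℕ} (ω : CConfig N) (S : Finset (Fin N)) (u : Fin N) : ℕ :=
  (S.filter fun v => adjOf (redConf ω) u v).card

/-- The **Correction** subroutine with threshold `t`: a vertex of `P.i` is bad if it has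
at least `t` Blue neighbors in the other class; bad vertices are moved to the other side. -/
noncomputable def corrected2 {N : ℕ} (t : ℝ) (ω : CConfig N)
    (P : Finset (Fin N) × Finset (Fin N)) : Finset (Fin N) × Finset (Fin N) :=
  let bad1 := P.1.filter fun u => t ≤ (blueDegIn ω P.2 u : ℝ)
  let bad2 := P.2.filter fun u => t ≤ (blueDegIn ω P.1 u : ℝ)
  ((P.1 \ bad1) ∪ bad2, (P.2 \ bad2) ∪ bad1)

/-- The `k`-block SBM on `k*m` vertices (`k` blocks of size `m`, so `n = k*m` total
vertices and edge probabilities `a/n` within blocks and `b/n` across). -/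
noncomputable def sbmK (k m : ℕ) (a b : ℝ) : Measure (Config (k * m)) :=
  Measure.pi fun e =>
    bern (if (e.1.1 : ℕ) / m = (e.1.2 : ℕ) / m then a / (k * m) else b / (k * m))

/-- The `i`-th block `Vᵢ` (of size `m = n/k`). -/
def blockK (k m : ℕ) (i : Fin k) : Finset (Fin (k * m)) :=
  univ.filter fun v => (v : ℕ) / m = (i : ℕ)

/-- The subset `Z` selected by the splitting coins `s` (its complement is `Y`). -/
def Zset {N : ℕ} (s : Fin N → Bool) : Finset (Fin N) := univ.filter fun v => s v = true

/-- The `k`-block SBM together with a uniformly random split of the vertices. -/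
noncomputable def sbmKs (k m : ℕ) (a b : ℝ) :
    Measure ((Fin (k * m) → Bool) × Config (k * m)) :=
  (Measure.pi fun _ : Fin (k * m) => bern (1 / 2)).prod (sbmK k m a b)

/-- The `k`-block SBM together with a uniformly random split of the vertices and an
independent fair Red/Blue coloring of each edge. -/
noncomputable def sbmKsc (k m : ℕ) (a b : ℝ) :
    Measure ((Fin (k * m) → Bool) × CConfig (k * m)) :=
  (Measure.pi fun _ : Fin (k * m) => bern (1 / 2)).prod
    (Measure.pi fun e : EdgeIdx (k * m) =>
      (bern (if (e.1.1 : ℕ) / m = (e.1.2 : ℕ) / m then a / (k * m) else b / (k * m))).prod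
        (bern (1 / 2)))

/-- `U` is a `γ`-correct partition of `Z = (V₁ ∩ Z) ∪ ... ∪ (V_k ∩ Z)`:
a collection of disjoint subsets of `Z` covering `Z` with
`|(Vᵢ ∩ Z) ∩ Uᵢ| ≥ (1-γ)|Vᵢ ∩ Z|` for every `i`. -/
def correctOnZ (k m : ℕ) (γ : ℝ) (s : Fin (k * m) → Bool)
    (U : Fin k → Finset (Fin (k * m))) : Prop :=
  (∀ i, U i ⊆ Zset s) ∧ (∀ i j, i ≠ j → Disjoint (U i) (U j)) ∧
  (univ.biUnion U = Zset s) ∧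
  ∀ i, (1 - γ) * ((blockK k m i ∩ Zset s).card : ℝ) ≤
    (((blockK k m i ∩ Zset s) ∩ U i).card : ℝ)

/-- Censor block model: for every pair of vertices, an independent pair
(edge present with probability `p`, noise bit with probability `ε`). -/
noncomputable def cbmMeasure (n : ℕ) (p ε : ℝ) : Measure (CConfig (2 * n)) :=
  Measure.pi fun _ => (bern p).prod (bern ε)

/-- The observation `y = B_G x ⊕ z` of the censor block model: for each present edge
`(i,j)` one observes `x_i ⊕ x_j ⊕ z_e` (where `x` is the indicator of the second
block); nothing is observed on absent edges. -/
def cbmObs (n : ℕ) (ω : CConfig (2 * n)) (e : EdgeIdx (2 * n)) : Option Bool :=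
  if (ω e).1 then
    some (xor (xor (decide ((e.1.1 : ℕ) < n)) (decide ((e.1.2 : ℕ) < n))) (ω e).2)
  else none

/-- `e(S,T)`: adjacency-matrix count of edges between `S` and `T` in a simple graph. -/
def eCount {n : ℕ} (G : SimpleGraph (Fin n)) [DecidableRel G.Adj]
    (S T : Finset (Fin n)) : ℝ :=
  ∑ i ∈ S, ∑ j ∈ T, if G.Adj i j then 1 else 0

/-- `e(S,T)` for the graph of a configuration. -/
def eCountC {n : ℕ} (ω : Config n) (S T : Finset (Fin n)) : ℝ :=
  ∑ i ∈ S, ∑ j ∈ T, if adjOf ω i j then 1 else 0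

/-- The random symmetric matrix model: independent edges, pair `(i,j)` present with
probability `p i j`. -/
noncomputable def genMeasure {n : ℕ} (p : Fin n → Fin n → ℝ) : Measure (Config n) :=
  Measure.pi fun e => bern (p e.1.1 e.1.2)

/-- The centered matrix `M` with `M_ij = 1 - p_ij` if the pair is present and
`M_ij = -p_ij` otherwise, and zero diagonal. -/
noncomputable def centeredMat {n : ℕ} (p : Fin n → Fin n → ℝ) (ω : Config n) :
    Matrix (Fin n) (Fin n) ℝ :=
  fun i j => if i = j then 0 else (if adjOf ω i j then 1 else 0) - p i j

/-- Number of positive entries in row `i` of `M`. -/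
noncomputable def posRowCount {n : ℕ} (M : Matrix (Fin n) (Fin n) ℝ) (i : Fin n) : ℕ :=
  (univ.filter fun j => 0 < M i j).card

/-- Zero out the rows and columns indexed by `S`. -/
noncomputable def zeroOutRows {n : ℕ} (S : Finset (Fin n)) (M : Matrix (Fin n) (Fin n) ℝ) :
    Matrix (Fin n) (Fin n) ℝ :=
  fun i j => if i ∈ S ∨ j ∈ S then 0 else M i j

/-- The all-ones direction `v̄₁` (unit vector). -/
noncomputable def vbar1 (n : ℕ) : EuclideanSpace ℝ (Fin (2 * n)) :=
  mkVec fun _ => 1 / Real.sqrt (2 * n)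

/-- The block-indicator direction `v̄₂` (unit vector). -/
noncomputable def vbar2 (n : ℕ) : EuclideanSpace ℝ (Fin (2 * n)) :=
  mkVec fun i =>
    if (i : ℕ) < n then 1 / Real.sqrt (2 * n) else -(1 / Real.sqrt (2 * n))

/-- The moment generating function bound for a Bernoulli variable. -/
theorem integral_bern_le {p : ℝ} (hp : 0 ≤ p) (f : Bool → ℝ) (hf : f false = 1)
    (hf1 : 1 ≤ f true) : ∫ x, f x ∂(bern p) ≤ Real.exp (p * (f true - 1)) := by
  have hq : ((min p.toNNReal 1 : NNReal) : ℝ) ≤ p := by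
    rw [NNReal.coe_min, Real.coe_toNNReal p hp]
    exact min_le_left _ _
  have h1 : ∫ x, f x ∂(bern p) = 1 + ((min p.toNNReal 1 : NNReal) : ℝ) * (f true - 1) := by
    unfold bern
    rw [PMF.integral_eq_sum]
    have h2 : (1 - min p.toNNReal 1 : NNReal) = (1 : ℝ) - (min p.toNNReal 1 : NNReal) :=
      NNReal.coe_sub (min_le_right _ _)
    simp only [Fintype.sum_bool, PMF.bernoulli_apply, cond_true, cond_false, hf, smul_eq_mul,
      ENNReal.coe_toReal, h2]
    ring
  rw [h1]
  have h3 := Real.add_one_le_exp (p * (f true - 1))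
  nlinarith [mul_le_mul_of_nonneg_right hq (sub_nonneg.2 hf1)]

/-- Summing over unordered pairs in both orientations is summing over ordered pairs. -/
theorem sum_edgeIdx_add_swap {N : ℕ} (h : Fin N → Fin N → ℝ) (h0 : ∀ i, h i i = 0) :
    ∑ e : EdgeIdx N, (h e.1.1 e.1.2 + h e.1.2 e.1.1) = ∑ i, ∑ j, h i j := by
  have key : ∀ g : Fin N → Fin N → ℝ,
      ∑ e : EdgeIdx N, g e.1.1 e.1.2 = ∑ i, ∑ j, if i < j then g i j else 0 := by
    intro g
    rw [← Fintype.sum_prod_type' (f := fun i j => if i < j then g i j else 0),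
      ← Finset.sum_filter]
    exact (Finset.sum_subtype (p := fun e : Fin N × Fin N => e.1 < e.2) _ (by simp)
      (fun e : Fin N × Fin N => g e.1 e.2)).symm
  rw [Finset.sum_add_distrib, key h, key (fun i j => h j i)]
  rw [Finset.sum_comm (f := fun i j => if i < j then h j i else 0), ← Finset.sum_add_distrib]
  refine Finset.sum_congr rfl fun i _ => ?_
  rw [← Finset.sum_add_distrib]
  refine Finset.sum_congr rfl fun j _ => ?_
  rcases lt_trichotomy i j with hij | rfl | hij
  · simp [hij, hij.not_gt]
  · simp [h0]
  · simp [hij, hij.not_gt]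

/-- The number of endpoints of a pair lying in `T`. -/
noncomputable def endpointCount {N : ℕ} (T : Finset (Fin N)) (e : EdgeIdx N) : ℝ :=
  (if e.1.1 ∈ T then 1 else 0) + (if e.1.2 ∈ T then 1 else 0)

theorem sum_mul_endpointCount {N : ℕ} (T : Finset (Fin N)) (g : Fin N → Fin N → ℝ)
    (h0 : ∀ i, g i i = 0) (hg : ∀ i j, g i j = g j i) :
    ∑ e : EdgeIdx N, g e.1.1 e.1.2 * endpointCount T e = ∑ i ∈ T, ∑ j, g i j := by
  have h := sum_edgeIdx_add_swap (fun i j => if i ∈ T then g i j else 0) (by simp [h0])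
  rw [Finset.sum_congr rfl fun i _ => show (∑ j, if i ∈ T then g i j else 0) =
    if i ∈ T then ∑ j, g i j else 0 by split_ifs <;> simp, ← Finset.sum_filter] at h
  simp only [Finset.filter_mem_eq_inter, Finset.univ_inter] at h
  rw [← h]
  refine Finset.sum_congr rfl fun e _ => ?_
  rw [hg e.1.2 e.1.1]
  unfold endpointCount
  split_ifs <;> ring

theorem adjOf_self {N : ℕ} (ω : Config N) (i : Fin N) : adjOf ω i i = false := by
  simp [adjOf]

theorem adjOf_comm {N : ℕ} (ω : Config N) (i j : Fin N) : adjOf ω i j = adjOf ω j i := by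
  unfold adjOf
  rcases lt_trichotomy i j with h | rfl | h
  · simp [h, h.not_gt]
  · rfl
  · simp [h, h.not_gt]

theorem sum_degOf {N : ℕ} (T : Finset (Fin N)) (ω : Config N) :
    ∑ v ∈ T, (degOf ω v : ℝ) =
      ∑ e : EdgeIdx N, (if ω e then 1 else 0) * endpointCount T e := by
  have h := sum_mul_endpointCount T (fun i j => if adjOf ω i j then (1 : ℝ) else 0)
    (by simp [adjOf_self]) (fun i j => by rw [adjOf_comm])
  have h1 : ∀ e : EdgeIdx N, adjOf ω e.1.1 e.1.2 = ω e := fun e => by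
    simp [adjOf, e.2]
  simp only [h1] at h
  rw [h]
  refine Finset.sum_congr rfl fun v _ => ?_
  simp [degOf]

theorem exp_half_endpointCount_le {N : ℕ} (T : Finset (Fin N)) (e : EdgeIdx N) :
    Real.exp (endpointCount T e / 2) - 1 ≤ endpointCount T e := by
  have h1 : Real.exp 1 ≤ 3 := by linarith [Real.exp_one_lt_d9]
  have h2 : Real.exp (1 / 2) ≤ 2 := by
    have h3 : Real.exp (1 / 2) * Real.exp (1 / 2) = Real.exp 1 := by
      rw [← Real.exp_add]; norm_num
    nlinarith [Real.exp_pos (1 / 2)]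
  unfold endpointCount
  split_ifs <;> norm_num at * <;> linarith

theorem expAdj_nonneg {n : ℕ} {a b : ℝ} (ha : 0 ≤ a) (hb : 0 ≤ b) (i j : Fin (2 * n)) :
    0 ≤ expAdj n a b i j := by
  unfold expAdj
  split_ifs <;> positivity

theorem expAdj_le {n : ℕ} {a b : ℝ} (ha : 0 ≤ a) (hab : b ≤ a) (i j : Fin (2 * n)) :
    expAdj n a b i j ≤ a / n := by
  unfold expAdj
  split_ifs
  · positivity
  · exact le_rfl
  · gcongr

theorem card_filter_val_lt (n : ℕ) :
    (univ.filter fun i : Fin (2 * n) => (i : ℕ) < n).card = n := by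
  rw [Fin.card_filter_val_lt]
  omega

theorem sum_expAdj_row_le {n : ℕ} (hn : 0 < n) {a b : ℝ} (ha : 0 ≤ a) (hb : 0 ≤ b)
    (i : Fin (2 * n)) : ∑ j, expAdj n a b i j ≤ a + b := by
  have hc := card_filter_val_lt n
  have hc' : (univ.filter fun i : Fin (2 * n) => ¬ (i : ℕ) < n).card = n := by
    have := Finset.card_filter_add_card_filter_not (s := (univ : Finset (Fin (2 * n))))
      (fun i : Fin (2 * n) => (i : ℕ) < n)
    rw [hc, Finset.card_univ, Fintype.card_fin] at this
    omega
  have hn' : (n : ℝ) ≠ 0 := by positivity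
  calc ∑ j, expAdj n a b i j
      ≤ ∑ j : Fin (2 * n), if ((i : ℕ) < n ↔ (j : ℕ) < n) then a / n else b / n := by
        refine Finset.sum_le_sum fun j _ => ?_
        unfold expAdj
        split_ifs <;> first | exact le_rfl | positivity
    _ = a + b := by
        by_cases hi : (i : ℕ) < n
        · simp only [hi, true_iff, Finset.sum_ite, Finset.sum_const, hc, hc', nsmul_eq_mul]
          field_simp
        · simp only [hi, false_iff, Finset.sum_ite, Finset.sum_const, hc, hc', nsmul_eq_mul,
            not_not]
          field_simp

/-- Chernoff bound for the total degree of a fixed vertex set. -/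
theorem sbm2_sum_degOf_ge_le {n : ℕ} (hn : 0 < n) {a b : ℝ} (ha : 0 ≤ a) (hb : 0 ≤ b)
    (T : Finset (Fin (2 * n))) (t : ℝ) :
    (sbm2 n a b).real {ω | t ≤ ∑ v ∈ T, (degOf ω v : ℝ)} ≤
      Real.exp (T.card * (a + b) - t / 2) := by
  have : IsProbabilityMeasure (sbm2 n a b) := by unfold sbm2; infer_instance
  let p : EdgeIdx (2 * n) → ℝ :=
    fun e => if ((e.1.1 : ℕ) < n ↔ (e.1.2 : ℕ) < n) then a / n else b / n
  have hp : ∀ e, 0 ≤ p e := fun e => by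
    simp only [p]; split_ifs <;> positivity
  have hpe : ∀ e, p e = expAdj n a b e.1.1 e.1.2 := fun e => by
    simp [p, expAdj, e.2.ne]
  let f : EdgeIdx (2 * n) → Bool → ℝ :=
    fun e x => Real.exp ((if x then 1 else 0) * endpointCount T e / 2)
  have hw : ∀ e, 0 ≤ endpointCount T e := fun e => by
    unfold endpointCount; positivity
  have hexp : ∀ ω : Config (2 * n),
      Real.exp ((∑ v ∈ T, (degOf ω v : ℝ)) / 2) = ∏ e, f e (ω e) := fun ω => by
    rw [sum_degOf, Finset.sum_div, Real.exp_sum]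
  have hint : ∫ ω, Real.exp ((∑ v ∈ T, (degOf ω v : ℝ)) / 2) ∂(sbm2 n a b) ≤
      Real.exp (T.card * (a + b)) := by
    simp only [hexp]
    unfold sbm2
    rw [MeasureTheory.integral_fintype_prod_eq_prod]
    calc ∏ e, ∫ x, f e x ∂(bern (p e))
        ≤ ∏ e, Real.exp (p e * endpointCount T e) := by
          refine Finset.prod_le_prod
            (fun e _ => integral_nonneg fun x => (Real.exp_pos _).le) fun e _ => ?_
          refine (integral_bern_le (hp e) (f e) (by simp [f]) ?_).trans ?_
          · simp only [f, if_true, one_mul]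
            exact Real.one_le_exp (by have := hw e; positivity)
          · refine Real.exp_le_exp.2 (mul_le_mul_of_nonneg_left ?_ (hp e))
            simpa [f] using exp_half_endpointCount_le T e
      _ = Real.exp (∑ i ∈ T, ∑ j, expAdj n a b i j) := by
          rw [← Real.exp_sum]
          simp only [hpe]
          rw [sum_mul_endpointCount T (expAdj n a b) (by simp [expAdj])]
          intro i j
          simp only [expAdj, eq_comm, iff_comm]
      _ ≤ Real.exp (T.card * (a + b)) := by
          refine Real.exp_le_exp.2 ?_
          rw [← nsmul_eq_mul]
          exact Finset.sum_le_card_nsmul _ _ _ fun i _ => sum_expAdj_row_le hn ha hb i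
  have hm := mul_meas_ge_le_integral_of_nonneg (μ := sbm2 n a b)
    (f := fun ω => Real.exp ((∑ v ∈ T, (degOf ω v : ℝ)) / 2))
    (Filter.Eventually.of_forall fun ω => (Real.exp_pos _).le) Integrable.of_finite
    (Real.exp (t / 2))
  simp only [Real.exp_le_exp, div_le_div_iff_of_pos_right (zero_lt_two' ℝ)] at hm
  rw [Real.exp_sub, le_div_iff₀ (Real.exp_pos _), mul_comm]
  exact hm.trans hint

/-- The operator norm is at most the Frobenius norm. -/
theorem opNorm_le_one_of_sum_sq_le {N : ℕ} (M : Matrix (Fin N) (Fin N) ℝ)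
    (h : ∑ i, ∑ j, M i j ^ 2 ≤ 1) : opNorm M ≤ 1 := by
  unfold opNorm
  refine ContinuousLinearMap.opNorm_le_bound _ zero_le_one fun x => ?_
  rw [one_mul, EuclideanSpace.norm_eq, EuclideanSpace.norm_eq]
  refine Real.sqrt_le_sqrt ?_
  simp only [Real.norm_eq_abs, sq_abs]
  calc ∑ i, (Matrix.toEuclideanLin M x) i ^ 2
      ≤ ∑ i, (∑ j, M i j ^ 2) * ∑ j, x j ^ 2 := by
        refine Finset.sum_le_sum fun i _ => ?_
        exact Finset.sum_mul_sq_le_sq_mul_sq univ (M i) (fun j => x j)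
    _ = (∑ i, ∑ j, M i j ^ 2) * ∑ j, x j ^ 2 := by rw [Finset.sum_mul]
    _ ≤ ∑ j, x j ^ 2 := mul_le_of_le_one_left (by positivity) h

/-- The vertices of degree exceeding `20 d`. -/
noncomputable def highDeg {N : ℕ} (d : ℝ) (ω : Config N) : Finset (Fin N) :=
  univ.filter fun v => 20 * d < (degOf ω v : ℝ)

theorem opNorm_delta_le_one {n : ℕ} (hn : 0 < n) {a b : ℝ} (ha : 0 ≤ a) (hb : 0 ≤ b)
    (hab : b ≤ a) (ω : Config (2 * n)) (d : ℝ)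
    (h : 4 * a ^ 2 * (highDeg d ω).card ≤ n) :
    opNorm (zeroOutHighDeg d ω (expAdj n a b) - expAdj n a b) ≤ 1 := by
  have hn' : (0 : ℝ) < n := by positivity
  refine opNorm_le_one_of_sum_sq_le _ ?_
  let q : Fin (2 * n) → ℝ := fun i => if 20 * d < (degOf ω i : ℝ) then (a / n) ^ 2 else 0
  have hq : ∑ i, q i = (highDeg d ω).card * (a / n) ^ 2 := by
    simp only [q]
    rw [← Finset.sum_filter, Finset.sum_const, nsmul_eq_mul]
    rfl
  calc ∑ i, ∑ j, (zeroOutHighDeg d ω (expAdj n a b) - expAdj n a b) i j ^ 2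
      ≤ ∑ i, ∑ j, (q i + q j) := by
        refine Finset.sum_le_sum fun i _ => Finset.sum_le_sum fun j _ => ?_
        have h1 : expAdj n a b i j ^ 2 ≤ (a / n) ^ 2 :=
          pow_le_pow_left₀ (expAdj_nonneg ha hb i j) (expAdj_le ha hab i j) 2
        have h2 : 0 ≤ (a / n) ^ 2 := by positivity
        simp only [Matrix.sub_apply, zeroOutHighDeg, q]
        by_cases hi : 20 * d < (degOf ω i : ℝ) <;> by_cases hj : 20 * d < (degOf ω j : ℝ) <;>
          simp [hi, hj] <;> linarith
    _ = 4 * a ^ 2 * (highDeg d ω).card / n := by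
        simp only [Finset.sum_add_distrib, Finset.sum_const, Finset.card_univ, Fintype.card_fin,
          nsmul_eq_mul, ← Finset.mul_sum, hq]
        push_cast
        field_simp
        ring
    _ ≤ 1 := (div_le_one hn').2 h

theorem choose_mul_pow_le_exp (m s : ℕ) {y : ℝ} (hy : 0 ≤ y) :
    (m.choose s : ℝ) * y ^ s ≤ Real.exp (m * y) := by
  have h : (m.choose s : ℝ) * y ^ s ≤ (y + 1) ^ m := by
    rcases lt_or_ge m s with hs | hs
    · rw [Nat.choose_eq_zero_of_lt hs]; simp only [Nat.cast_zero, zero_mul]; positivity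
    · rw [add_pow]
      have := Finset.single_le_sum (f := fun k => y ^ k * 1 ^ (m - k) * (m.choose k : ℝ))
        (fun k _ => by positivity) (Finset.mem_range.2 (Nat.lt_succ_of_le hs))
      simpa [mul_comm] using this
  refine h.trans ?_
  rw [Real.exp_nat_mul]
  exact pow_le_pow_left₀ (by positivity) (Real.add_one_le_exp y) m

/-- Tail bound for the number of vertices of degree exceeding `20 (a + b)`. -/
theorem sbm2_card_highDeg_ge_le {n : ℕ} (hn : 0 < n) {a b : ℝ} (ha : 1 ≤ a) (hb : 0 ≤ b)
    (hd : 2 ≤ a + b) {s : ℕ} (hs : (n : ℝ) ≤ 4 * a ^ 2 * s) :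
    (sbm2 n a b).real {ω | s ≤ (highDeg (a + b) ω).card} ≤ Real.exp (-s) := by
  have : IsProbabilityMeasure (sbm2 n a b) := by unfold sbm2; infer_instance
  have ha0 : 0 < a := by linarith
  have hchoose : ((2 * n).choose s : ℝ) ≤ Real.exp (s * (8 + 2 * (a + b))) := by
    have h1 := choose_mul_pow_le_exp (2 * n) s (y := (a ^ 2)⁻¹) (by positivity)
    rw [inv_pow, ← div_eq_mul_inv, div_le_iff₀ (by positivity)] at h1
    refine h1.trans ?_
    have h2 : (a ^ 2) ^ s ≤ Real.exp (s * (2 * (a + b))) := by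
      rw [Real.exp_nat_mul]
      refine pow_le_pow_left₀ (by positivity) ?_ s
      have h3 : a ≤ Real.exp (a + b) := by linarith [Real.add_one_le_exp (a + b)]
      calc a ^ 2 ≤ Real.exp (a + b) ^ 2 := pow_le_pow_left₀ ha0.le h3 2
        _ = Real.exp (2 * (a + b)) := by rw [← Real.exp_nat_mul]; norm_num
    have h4 : ((2 * n : ℕ) : ℝ) * (a ^ 2)⁻¹ ≤ s * 8 := by
      rw [← div_eq_mul_inv, div_le_iff₀ (by positivity)]
      push_cast
      linarith
    rw [mul_add, Real.exp_add]
    exact mul_le_mul (Real.exp_le_exp.2 h4) h2 (by positivity) (by positivity)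
  have hsub : {ω | s ≤ (highDeg (a + b) ω).card} ⊆
      ⋃ T ∈ Finset.powersetCard s (univ : Finset (Fin (2 * n))),
        {ω | s * (20 * (a + b)) ≤ ∑ v ∈ T, (degOf ω v : ℝ)} := by
    intro ω hω
    obtain ⟨T, hT, hTs⟩ := Finset.exists_subset_card_eq hω
    simp only [Set.mem_iUnion, Finset.mem_powersetCard, Set.mem_ofPred_eq]
    refine ⟨T, ⟨Finset.subset_univ _, hTs⟩, ?_⟩
    rw [← hTs, ← nsmul_eq_mul]
    exact Finset.card_nsmul_le_sum _ _ _ fun v hv => (Finset.mem_filter.1 (hT hv)).2.le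
  calc (sbm2 n a b).real {ω | s ≤ (highDeg (a + b) ω).card}
      ≤ ∑ T ∈ Finset.powersetCard s (univ : Finset (Fin (2 * n))),
          (sbm2 n a b).real {ω | s * (20 * (a + b)) ≤ ∑ v ∈ T, (degOf ω v : ℝ)} :=
        (measureReal_mono hsub (measure_ne_top _ _)).trans (measureReal_biUnion_finset_le _ _)
    _ ≤ ∑ T ∈ Finset.powersetCard s (univ : Finset (Fin (2 * n))),
          Real.exp (-(s * (9 * (a + b)))) := by
        refine Finset.sum_le_sum fun T hT => ?_
        refine (sbm2_sum_degOf_ge_le hn ha0.le hb T _).trans_eq ?_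
        rw [(Finset.mem_powersetCard.1 hT).2]
        congr 1
        ring
    _ = ((2 * n).choose s : ℝ) * Real.exp (-(s * (9 * (a + b)))) := by
        rw [Finset.sum_const, Finset.card_powersetCard, Finset.card_univ, Fintype.card_fin,
          nsmul_eq_mul]
    _ ≤ Real.exp (s * (8 + 2 * (a + b))) * Real.exp (-(s * (9 * (a + b)))) := by gcongr
    _ ≤ Real.exp (-s) := by
        rw [← Real.exp_add]
        refine Real.exp_le_exp.2 ?_
        have : (0 : ℝ) ≤ s := Nat.cast_nonneg s
        nlinarith

/-- Corollary 3.2 / `thm:deltabound`: with `Ā` obtained from the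
expected adjacency matrix `Ā₀` of `SBM(n,a,b)` by zeroing out the rows and columns of
the vertices of (sampled) degree `> 20d`, `d := a+b ≥ d₀`, the matrix `Δ := Ā - Ā₀`
satisfies `‖Δ‖ ≤ 1` with probability at least `1 - exp(-Ω(a⁻³ n))`. -/
theorem sbm_delta_norm_le_one :
    ∃ d₀ c : ℝ, 0 < c ∧ ∀ a b : ℝ, 0 < b → b < a → d₀ ≤ a + b →
      ∀ n : ℕ,
        1 - ENNReal.ofReal (Real.exp (-(c * a⁻¹ ^ 3 * n))) ≤
          sbm2 n a b
            {ω | opNorm (zeroOutHighDeg (a + b) ω (expAdj n a b) - expAdj n a b) ≤ 1} := by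
  refine ⟨2, 1 / 4, by norm_num, fun a b hb hab hd n => ?_⟩
  rcases Nat.eq_zero_or_pos n with rfl | hn
  · simp
  have : IsProbabilityMeasure (sbm2 n a b) := by unfold sbm2; infer_instance
  have ha : 1 ≤ a := by linarith
  have ha0 : 0 < a := by linarith
  obtain ⟨s, hs⟩ : ∃ s : ℕ, s = ⌊(n : ℝ) / (4 * a ^ 2)⌋₊ + 1 := ⟨_, rfl⟩
  have hns : (n : ℝ) / (4 * a ^ 2) < s := by
    rw [hs]; push_cast; exact Nat.lt_floor_add_one _
  have htail := sbm2_card_highDeg_ge_le hn ha hb.le hd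
    (s := s) (by rw [div_lt_iff₀ (by positivity)] at hns; linarith)
  have hcompl : {ω | s ≤ (highDeg (a + b) ω).card}ᶜ ⊆
      {ω | opNorm (zeroOutHighDeg (a + b) ω (expAdj n a b) - expAdj n a b) ≤ 1} := by
    intro ω hω
    refine opNorm_delta_le_one hn ha0.le hb.le hab.le ω _ ?_
    rw [Set.mem_compl_iff, Set.mem_ofPred_eq, not_le, hs, Nat.lt_succ_iff,
      Nat.le_floor_iff (by positivity), le_div_iff₀ (by positivity)] at hω
    linarith
  refine le_trans ?_ (measure_mono hcompl)
  rw [prob_compl_eq_one_sub (Set.toFinite _).measurableSet]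
  refine tsub_le_tsub_left ?_ 1
  rw [← ofReal_measureReal]
  refine ENNReal.ofReal_le_ofReal (htail.trans (Real.exp_le_exp.2 (neg_le_neg ?_)))
  refine le_trans ?_ hns.le
  have h3 : a⁻¹ ^ 3 ≤ a⁻¹ ^ 2 :=
    pow_le_pow_of_le_one (by positivity) (inv_le_one_of_one_le₀ ha) (by norm_num)
  calc 1 / 4 * a⁻¹ ^ 3 * n ≤ 1 / 4 * a⁻¹ ^ 2 * n := by gcongr
    _ = n / (4 * a ^ 2) := by field_simp
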